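/- Let α > 0, K ≥ 0 and k ∈ ℕ. For each m ∈ ℤ² with m ≠ 0, let ξ_m ≥ (α²/π²)|m|², let c_m¹, b_m ∈ ℂ³ and d̃_m ∈ ℂ with |b_m| ≤ K and |d̃_m| ≤ K|c_m¹|, and assume S² := ∑_{m ≠ 0} |c_m¹|² < ∞. Define for t ≤ 1: c_m(t) = (c_m¹ − 2π√(ξ_m) (t−1) d̃_m b_m) e^{2π√(ξ_m) (t−1)}. Then there is a constant C depending only on K and k such that for every t < 1: (∑_{m ≠ 0} |m|^{2k} |c_m(t)|²)^{1/2} ≤ C (1 + (α(1−t))^{−k}) e^{α(t−1)/2} S. -/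

import Mathlib

open MeasureTheory

/-- A polynomial weight of degree `k` times `1 + L * s` is absorbed by half of the decay of
`exp (-s)`, uniformly in `s ≥ 2 * r * y` and `r ≥ 1`. -/
theorem pow_mul_exp_neg_mul_le {L r y s : ℝ} (k : ℕ) (hL : 0 ≤ L) (hr : 1 ≤ r) (hy : 0 < y)
    (hs : 2 * r * y ≤ s) :
    r ^ k * (Real.exp (-s) * (1 + L * s)) ≤
      (k.factorial * 4 ^ k * (1 + 4 * L)) * (1 + y ^ (-(k : ℤ))) * Real.exp (-y / 2) := by
  have hry : y ≤ r * y := le_mul_of_one_le_left hy.le hr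
  have hs0 : 0 ≤ s := by linarith
  have hpow : r ^ k ≤ k.factorial * 4 ^ k * Real.exp (s / 4) * y ^ (-(k : ℤ)) := by
    have hexp : (s / 4) ^ k / k.factorial ≤ Real.exp (s / 4) :=
      Real.pow_div_factorial_le_exp _ (by positivity) k
    rw [div_le_iff₀ (by positivity), div_pow, div_le_iff₀ (by positivity)] at hexp
    have hrys : (r * y) ^ k ≤ s ^ k := by gcongr; linarith
    rw [zpow_neg, zpow_natCast, ← div_eq_mul_inv, le_div_iff₀ (by positivity), ← mul_pow]
    linarith
  have hlin : 1 + L * s ≤ (1 + 4 * L) * Real.exp (s / 4) := by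
    have hexp := Real.add_one_le_exp (s / 4)
    nlinarith [mul_le_mul_of_nonneg_left hexp hL]
  have hy' : y ^ (-(k : ℤ)) ≤ 1 + y ^ (-(k : ℤ)) := by linarith
  have hdecay : Real.exp (s / 4) * (Real.exp (-s) * Real.exp (s / 4)) ≤ Real.exp (-y / 2) := by
    rw [← Real.exp_add, ← Real.exp_add]
    exact Real.exp_le_exp.mpr (by linarith)
  calc r ^ k * (Real.exp (-s) * (1 + L * s))
      ≤ (k.factorial * 4 ^ k * Real.exp (s / 4) * y ^ (-(k : ℤ))) *
          (Real.exp (-s) * ((1 + 4 * L) * Real.exp (s / 4))) := by gcongr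
    _ = (k.factorial * 4 ^ k * (1 + 4 * L)) * y ^ (-(k : ℤ)) *
          (Real.exp (s / 4) * (Real.exp (-s) * Real.exp (s / 4))) := by ring
    _ ≤ _ := by gcongr

/-- The squared Euclidean norm of a nonzero integer vector is at least one. -/
theorem one_le_sq_add_sq_of_ne_zero {m : ℤ × ℤ} (hm : m ≠ 0) :
    (1 : ℝ) ≤ (m.1 : ℝ) ^ 2 + (m.2 : ℝ) ^ 2 := by
  have hpos : 0 < m.1 ^ 2 + m.2 ^ 2 := by
    by_contra! h
    have h1 : m.1 = 0 := by nlinarith [sq_nonneg m.1, sq_nonneg m.2]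
    have h2 : m.2 = 0 := by nlinarith [sq_nonneg m.1, sq_nonneg m.2]
    exact hm (Prod.ext h1 h2)
  exact_mod_cast hpos

/-- Norm bound for a damped vector with an affine correction. -/
theorem norm_exp_smul_sub_le {E : Type*} [NormedAddCommGroup E] [NormedSpace ℂ E]
    {K u : ℝ} (hK : 0 ≤ K) (hu : u ≤ 0) {x b : E} {d : ℂ} (hb : ‖b‖ ≤ K) (hd : ‖d‖ ≤ K * ‖x‖) :
    ‖Real.exp u • (x - ((u : ℂ) * d) • b)‖ ≤ Real.exp u * (1 + K ^ 2 * -u) * ‖x‖ := by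
  have hu' : 0 ≤ -u := by linarith
  rw [norm_smul, Real.norm_eq_abs, Real.abs_exp, mul_assoc]
  gcongr
  calc ‖x - ((u : ℂ) * d) • b‖ ≤ ‖x‖ + ‖((u : ℂ) * d) • b‖ := norm_sub_le _ _
    _ = ‖x‖ + -u * ‖d‖ * ‖b‖ := by
        rw [norm_smul, norm_mul, Complex.norm_real, Real.norm_eq_abs, abs_of_nonpos hu]
    _ ≤ ‖x‖ + -u * (K * ‖x‖) * K := by gcongr
    _ = (1 + K ^ 2 * -u) * ‖x‖ := by ring

/-- Domination of the terms of a series by `D ^ 2 * g` gives summability and an estimate of the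
square root of the sum. -/
theorem summable_and_sqrt_tsum_le {ι : Type*} {f g : ι → ℝ} {D : ℝ} (hD : 0 ≤ D)
    (hf : ∀ i, 0 ≤ f i) (hg : Summable g) (hfg : ∀ i, f i ≤ D ^ 2 * g i) :
    Summable f ∧ √(∑' i, f i) ≤ D * √(∑' i, g i) := by
  have hsum : Summable f := .of_nonneg_of_le hf hfg (hg.mul_left _)
  refine ⟨hsum, ?_⟩
  calc √(∑' i, f i) ≤ √(D ^ 2 * ∑' i, g i) := by
        rw [← tsum_mul_left]
        exact Real.sqrt_le_sqrt (hsum.tsum_le_tsum hfg (hg.mul_left _))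
    _ = D * √(∑' i, g i) := by rw [Real.sqrt_mul (sq_nonneg D), Real.sqrt_sq hD]

/-- Weighted decay estimate (3.19) for the tangential derivatives of order `k` of the boundary
layer velocity: the derivatives still decay exponentially (at rate `α/2`) away from the interface
`{t = 1}`, at the cost of a singular factor `(1−t)^{−k}`, with a constant depending only on `K`
and `k`. -/
theorem stmt_7 (K : ℝ) (hK : 0 ≤ K) (k : ℕ) :
    ∃ C : ℝ, 0 < C ∧
      ∀ (α : ℝ), 0 < α →
      ∀ (ξ : ℤ × ℤ → ℝ) (c1 b : ℤ × ℤ → EuclideanSpace ℂ (Fin 3)) (dt : ℤ × ℤ → ℂ),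
        (∀ m : ℤ × ℤ, m ≠ 0 →
          (α ^ 2 / Real.pi ^ 2) * ((m.1 : ℝ) ^ 2 + (m.2 : ℝ) ^ 2) ≤ ξ m) →
        (∀ m : ℤ × ℤ, m ≠ 0 → ‖b m‖ ≤ K) →
        (∀ m : ℤ × ℤ, m ≠ 0 → ‖dt m‖ ≤ K * ‖c1 m‖) →
        (Summable fun m : {m : ℤ × ℤ // m ≠ 0} => ‖c1 m.1‖ ^ 2) →
        ∀ (c : ℤ × ℤ → ℝ → EuclideanSpace ℂ (Fin 3)),
        (∀ m : ℤ × ℤ, m ≠ 0 → ∀ t ≤ (1:ℝ),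
          c m t = Real.exp (2 * Real.pi * Real.sqrt (ξ m) * (t - 1)) •
            (c1 m - (((2 * Real.pi * Real.sqrt (ξ m) * (t - 1) : ℝ) : ℂ) * dt m) • b m)) →
        ∀ t : ℝ, t < 1 →
          (Summable fun m : {m : ℤ × ℤ // m ≠ 0} =>
            ((m.1.1 : ℝ) ^ 2 + (m.1.2 : ℝ) ^ 2) ^ k * ‖c m.1 t‖ ^ 2) ∧
          Real.sqrt (∑' m : {m : ℤ × ℤ // m ≠ 0},
              ((m.1.1 : ℝ) ^ 2 + (m.1.2 : ℝ) ^ 2) ^ k * ‖c m.1 t‖ ^ 2) ≤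
            C * (1 + (α * (1 - t)) ^ (-(k : ℤ))) * Real.exp (α * (t - 1) / 2) *
              Real.sqrt (∑' m : {m : ℤ × ℤ // m ≠ 0}, ‖c1 m.1‖ ^ 2) := by
  refine ⟨k.factorial * 4 ^ k * (1 + 4 * K ^ 2), by positivity, ?_⟩
  intro α hα ξ c1 b dt hξ hb hdt hsum c hc t ht
  have hy : 0 < α * (1 - t) := mul_pos hα (by linarith)
  refine summable_and_sqrt_tsum_le (by positivity) (fun m => by positivity) hsum ?_
  rintro ⟨m, hm⟩
  set R : ℝ := (m.1 : ℝ) ^ 2 + (m.2 : ℝ) ^ 2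
  have hR1 : 1 ≤ R := one_le_sq_add_sq_of_ne_zero hm
  have hroot : α * √R ≤ Real.pi * √(ξ m) := by
    have h : α / Real.pi * √R ≤ √(ξ m) := by
      refine Real.le_sqrt_of_sq_le ?_
      rw [mul_pow, div_pow, Real.sq_sqrt (by linarith)]
      exact hξ m hm
    rw [div_mul_eq_mul_div, div_le_iff₀ Real.pi_pos] at h
    linarith
  set u : ℝ := 2 * Real.pi * √(ξ m) * (t - 1) with hu
  have hus : 2 * √R * (α * (1 - t)) ≤ -u := by
    have := mul_le_mul_of_nonneg_right hroot (by linarith : 0 ≤ 1 - t)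
    rw [hu]
    linarith
  have hu0 : u ≤ 0 := by
    have : 0 ≤ 2 * √R * (α * (1 - t)) := by positivity
    linarith
  have hnorm : ‖c m t‖ ≤ Real.exp u * (1 + K ^ 2 * -u) * ‖c1 m‖ := by
    rw [hc m hm t ht.le]
    exact norm_exp_smul_sub_le hK hu0 (hb m hm) (hdt m hm)
  have hweight := pow_mul_exp_neg_mul_le k (sq_nonneg K) (Real.one_le_sqrt.mpr hR1) hy hus
  rw [neg_neg, show -(α * (1 - t)) / 2 = α * (t - 1) / 2 by ring] at hweight
  calc R ^ k * ‖c m t‖ ^ 2 = (√R ^ k * ‖c m t‖) ^ 2 := by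
        rw [mul_pow, ← pow_mul, mul_comm k, pow_mul, Real.sq_sqrt (by linarith)]
    _ ≤ (√R ^ k * (Real.exp u * (1 + K ^ 2 * -u) * ‖c1 m‖)) ^ 2 := by gcongr
    _ = (√R ^ k * (Real.exp u * (1 + K ^ 2 * -u))) ^ 2 * ‖c1 m‖ ^ 2 := by ring
    _ ≤ _ := by
        have : 0 ≤ -u := by linarith
        gcongr
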